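/- Let Ω be a finite ground set with |Ω| = n, let f : 2^Ω → ℝ be monotone and submodular, let k ≥ 1 be an integer, let S* ⊆ Ω with |S*| ≤ k, let S ⊆ Ω, let ε ∈ (0,1), and let r ≥ 0. Let f̄ : 2^Ω → ℝ satisfy |f̄(S ∪ {a}) − f(S ∪ {a})| < r for every a ∈ Ω∖S. Let s be a positive integer with (n − |S|)·log(1/ε)/k ≤ s ≤ n − |S|, let A be a subset of Ω∖S of cardinality s chosen uniformly at random among all such subsets, and let â(A) ∈ A be any element maximizing f̄(S ∪ {a}) over a ∈ A. Then E_A[ f(S ∪ {â(A)}) ] − f(S) ≥ ((1−ε)/k)·( f(S*) − f(S) ) − 2r. -/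

import Mathlib

open Finset in
theorem sub_le_sum_marginals {α : Type*} [DecidableEq α] {Ω S : Finset α} {f : Finset α → ℝ}
    (hsub : ∀ A B : Finset α, A ⊆ B → B ⊆ Ω → ∀ x ∈ Ω, x ∉ B →
      f (insert x A) - f A ≥ f (insert x B) - f B)
    (hS : S ⊆ Ω) (T : Finset α) (hT : T ⊆ Ω \ S) :
    f (T ∪ S) - f S ≤ ∑ a ∈ T, (f (insert a S) - f S) := by
  induction T using Finset.induction_on with
  | empty => simp
  | insert a T ha ih =>
    obtain ⟨haU, hTU⟩ := insert_subset_iff.1 hT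
    obtain ⟨haΩ, haS⟩ := mem_sdiff.1 haU
    have h := hsub S (T ∪ S) subset_union_right
      (union_subset (hTU.trans sdiff_subset) hS) a haΩ (by simp [ha, haS])
    rw [sum_insert ha, insert_union]
    linarith [ih hTU]

theorem choose_sub_le_choose_mul_exp {N s t : ℕ} (ht : t ≤ N) :
    ((N - t).choose s : ℝ) ≤ N.choose s * Real.exp (-(s * t / N)) := by
  induction t with
  | zero => simp
  | succ t ih =>
    obtain ⟨M, rfl⟩ := Nat.exists_eq_add_of_le ht
    have e1 : t + 1 + M - (t + 1) = M := by omega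
    have e2 : t + 1 + M - t = M + 1 := by omega
    have hih := ih (by omega)
    rw [e2] at hih
    rw [e1]
    set N : ℝ := ((t + 1 + M : ℕ) : ℝ) with hN
    have hMN : (M : ℝ) + 1 ≤ N := by
      rw [hN]; push_cast; linarith [(Nat.cast_nonneg t : (0 : ℝ) ≤ t)]
    have hM : (0 : ℝ) < (M : ℝ) + 1 := by positivity
    have step : (M.choose s : ℝ) ≤ (M + 1).choose s * Real.exp (-(s / N)) := by
      rcases Nat.lt_or_ge M s with h | h
      · rw [Nat.choose_eq_zero_of_lt h]; push_cast; positivity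
      · have h1 : (M.choose s : ℝ) * (M + 1) = (M + 1).choose s * ((M + 1) - s) := by
          have := Nat.choose_mul_succ_eq M s
          rw [← Nat.cast_inj (R := ℝ)] at this
          push_cast [Nat.cast_sub (by omega : s ≤ M + 1)] at this
          exact this
        have h2 : (M.choose s : ℝ) = (M + 1).choose s * (1 - s / (M + 1)) := by
          field_simp; linarith
        rw [h2]
        gcongr
        have h3 : (s : ℝ) / N ≤ s / (M + 1) := by gcongr
        linarith [Real.add_one_le_exp (-(s / N : ℝ))]
    calc (M.choose s : ℝ) ≤ (M + 1).choose s * Real.exp (-(s / N)) := step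
      _ ≤ ((t + 1 + M).choose s * Real.exp (-(s * t / N))) * Real.exp (-(s / N)) := by gcongr
      _ = _ := by
        rw [mul_assoc, ← Real.exp_add]; push_cast; congr 2; ring

open Finset in
/-- The fraction of `s`-subsets of `U` that miss `T` is at most `1 - (1 - ε) |T| / k`. -/
theorem card_powersetCard_sdiff_le {α : Type*} [DecidableEq α] {U T : Finset α} (hTU : T ⊆ U)
    {k s : ℕ} (hk : 1 ≤ k) (hTk : #T ≤ k) (hs : 1 ≤ s) (hsU : s ≤ #U) {ε : ℝ} (hε : 0 < ε)
    (hslow : (#U : ℝ) * Real.log (1 / ε) / k ≤ s) :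
    (#((U \ T).powersetCard s) : ℝ) ≤ #(U.powersetCard s) * (1 - (1 - ε) * #T / k) := by
  have hk' : (0 : ℝ) < k := by exact_mod_cast hk
  have hU : (0 : ℝ) < #U := by exact_mod_cast hs.trans hsU
  have hτ : (#T : ℝ) / k ≤ 1 := (div_le_one hk').2 (by exact_mod_cast hTk)
  rw [card_powersetCard, card_powersetCard, card_sdiff_of_subset hTU]
  refine (choose_sub_le_choose_mul_exp (card_le_card hTU)).trans ?_
  gcongr
  have hlog : Real.log (1 / ε) ≤ s * k / #U := by
    rw [div_le_iff₀ hk'] at hslow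
    rw [le_div_iff₀ hU]; linarith
  calc Real.exp (-(s * #T / #U)) = Real.exp ((#T / k : ℝ) * (-(s * k / #U))) := by
        congr 1; field_simp
    _ ≤ Real.exp ((#T / k : ℝ) * Real.log ε) := by
        gcongr
        rw [one_div, Real.log_inv] at hlog
        linarith
    _ ≤ #T / k * Real.exp (Real.log ε) + (1 - #T / k) * Real.exp 0 := by
        have hτ0 : (0 : ℝ) ≤ #T / k := by positivity
        have := convexOn_exp.2 (Set.mem_univ (Real.log ε)) (Set.mem_univ (0 : ℝ)) hτ0
          (sub_nonneg.2 hτ) (add_sub_cancel _ _)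
        simpa using this
    _ = _ := by rw [Real.exp_log hε, Real.exp_zero]; ring

open Finset in
theorem sum_inv_card_inter_eq_of_mem {α : Type*} [DecidableEq α] {U T : Finset α} (hTU : T ⊆ U)
    (s : ℕ) {a b : α} (ha : a ∈ T) (hb : b ∈ T) :
    ∑ A ∈ U.powersetCard s with a ∈ A, (#(A ∩ T) : ℝ)⁻¹ =
      ∑ A ∈ U.powersetCard s with b ∈ A, (#(A ∩ T) : ℝ)⁻¹ := by
  have hmap : ∀ V : Finset α, a ∈ V → b ∈ V → V.map (Equiv.swap a b).toEmbedding = V := by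
    intro V haV hbV
    refine eq_of_subset_of_card_le (fun x hx => ?_) (card_map _).ge
    obtain ⟨y, hy, rfl⟩ := mem_map.1 hx
    simp only [Equiv.coe_toEmbedding, Equiv.swap_apply_def]
    split_ifs <;> assumption
  refine sum_equiv (Equiv.swap a b).finsetCongr (fun A => ?_) (fun A _ => ?_)
  · simp only [mem_filter, mem_powersetCard, Equiv.finsetCongr_apply, card_map]
    nth_rewrite 2 [← hmap U (hTU ha) (hTU hb)]
    rw [map_subset_map, mem_map_equiv, Equiv.symm_swap, Equiv.swap_apply_right]
  · nth_rewrite 2 [← hmap T ha hb]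
    rw [Equiv.finsetCongr_apply, ← map_inter, card_map]

open Finset in
/-- Averaging `g` over `A ∩ T` and summing over the `s`-subsets `A` of `U` weights all elements
of `T` equally. -/
theorem card_mul_sum_average_inter {α : Type*} [DecidableEq α] {U T : Finset α} (hTU : T ⊆ U)
    (s : ℕ) (g : α → ℝ) :
    #T * ∑ A ∈ U.powersetCard s, (#(A ∩ T) : ℝ)⁻¹ * ∑ a ∈ A ∩ T, g a =
      (#(U.powersetCard s) - #((U \ T).powersetCard s)) * ∑ a ∈ T, g a := by
  have hswap : ∀ h : α → ℝ,
      ∑ A ∈ U.powersetCard s, (#(A ∩ T) : ℝ)⁻¹ * ∑ a ∈ A ∩ T, h a =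
        ∑ a ∈ T, (∑ A ∈ U.powersetCard s with a ∈ A, (#(A ∩ T) : ℝ)⁻¹) * h a := by
    intro h
    simp_rw [mul_sum, sum_mul]
    refine sum_comm' fun A a => ?_
    simp only [mem_inter, mem_filter]
    tauto
  rcases T.eq_empty_or_nonempty with rfl | ⟨b, hb⟩
  · simp
  set w := ∑ A ∈ U.powersetCard s with b ∈ A, (#(A ∩ T) : ℝ)⁻¹ with hw
  have hconst : ∀ h : α → ℝ,
      ∑ A ∈ U.powersetCard s, (#(A ∩ T) : ℝ)⁻¹ * ∑ a ∈ A ∩ T, h a = w * ∑ a ∈ T, h a := by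
    intro h
    rw [hswap, mul_sum]
    exact sum_congr rfl fun a ha => by rw [sum_inv_card_inter_eq_of_mem hTU s ha hb]
  have hcount : (#T : ℝ) * w = #(U.powersetCard s) - #((U \ T).powersetCard s) := by
    have h1 := hconst fun _ => 1
    have hfilter : (U.powersetCard s).filter (fun A => A ∩ T = ∅) = (U \ T).powersetCard s := by
      ext A
      simp only [mem_filter, mem_powersetCard, subset_sdiff, disjoint_iff_inter_eq_empty]
      tauto
    have h2 : ∀ A ∈ U.powersetCard s, (#(A ∩ T) : ℝ)⁻¹ * ∑ a ∈ A ∩ T, (1 : ℝ) =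
        1 - if A ∩ T = ∅ then 1 else 0 := by
      intro A _
      split_ifs with h
      · simp [h]
      · have : (#(A ∩ T) : ℝ) ≠ 0 := by simpa using h
        simp [this]
    rw [sum_congr rfl h2, sum_sub_distrib, sum_boole, hfilter] at h1
    simp only [sum_const, nsmul_eq_mul, mul_one] at h1
    linarith
  rw [hconst, ← hcount]
  ring


/-- Lemma 1 of the paper. With `f` monotone submodular on `Ω` (`|Ω| = n`),
`S* ⊆ Ω` with `|S*| ≤ k`, `S ⊆ Ω`, `ε ∈ (0,1)`, `r ≥ 0`, an empirical-mean function `f̄` with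
`|f̄(S∪{a}) − f(S∪{a})| < r` for all `a ∈ Ω∖S`, a sample size `s` with
`(n − |S|)·log(1/ε)/k ≤ s ≤ n − |S|`, and `â(A)` an empirical maximizer of `f̄(S∪{·})` over
each size-`s` subset `A ⊆ Ω∖S`, the expectation over a uniformly random such `A` satisfies
`E_A[f(S ∪ {â(A)})] − f(S) ≥ ((1−ε)/k)·(f(S*) − f(S)) − 2r`. -/
theorem stmt3 {α : Type*} [DecidableEq α] (Ω : Finset α) (n : ℕ) (hn : Ω.card = n)
    (f : Finset α → ℝ)
    (hmono : ∀ A B : Finset α, A ⊆ B → B ⊆ Ω → f A ≤ f B)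
    (hsub : ∀ A B : Finset α, A ⊆ B → B ⊆ Ω → ∀ x ∈ Ω, x ∉ B →
      f (insert x A) - f A ≥ f (insert x B) - f B)
    (k : ℕ) (hk : 1 ≤ k)
    (Sstar : Finset α) (hSstarsub : Sstar ⊆ Ω) (hSstarcard : Sstar.card ≤ k)
    (S : Finset α) (hS : S ⊆ Ω)
    (ε : ℝ) (hε : ε ∈ Set.Ioo (0 : ℝ) 1)
    (r : ℝ) (hr : 0 ≤ r)
    (fbar : Finset α → ℝ)
    (hconc : ∀ a ∈ Ω \ S, |fbar (insert a S) - f (insert a S)| < r)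
    (s : ℕ) (hs : 1 ≤ s)
    (hslow : ((n : ℝ) - S.card) * Real.log (1 / ε) / k ≤ s)
    (hshigh : (s : ℝ) ≤ (n : ℝ) - S.card)
    (ahat : Finset α → α)
    (hahatmem : ∀ A ∈ (Ω \ S).powersetCard s, ahat A ∈ A)
    (hahatmax : ∀ A ∈ (Ω \ S).powersetCard s, ∀ a ∈ A,
      fbar (insert a S) ≤ fbar (insert (ahat A) S)) :
    (1 / (((Ω \ S).powersetCard s).card : ℝ)) *
        ∑ A ∈ (Ω \ S).powersetCard s, f (insert (ahat A) S)
      - f S ≥ ((1 - ε) / k) * (f Sstar - f S) - 2 * r := by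
  set U := Ω \ S with hU
  set T := Sstar \ S with hT
  have hTU : T ⊆ U := Finset.sdiff_subset_sdiff hSstarsub subset_rfl
  have hTk : T.card ≤ k := (Finset.card_le_card Finset.sdiff_subset).trans hSstarcard
  have hUcard : (U.card : ℝ) = n - S.card := by
    rw [hU, Finset.card_sdiff_of_subset hS, Nat.cast_sub (Finset.card_le_card hS), hn]
  have hsU : s ≤ U.card := by rw [← hUcard] at hshigh; exact_mod_cast hshigh
  have hk' : (0 : ℝ) < k := by exact_mod_cast hk
  set g : α → ℝ := fun a => f (insert a S) - f S with hg
  have hg0 : ∀ a ∈ U, 0 ≤ g a := fun a ha =>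
    sub_nonneg.2 (hmono _ _ (Finset.subset_insert a S)
      (Finset.insert_subset (Finset.mem_sdiff.1 ha).1 hS))
  set P := U.powersetCard s with hP
  have hP0 : (0 : ℝ) < P.card := by
    rw [hP, Finset.card_powersetCard]; exact_mod_cast Nat.choose_pos hsU
  have hexp : (1 / (P.card : ℝ)) * ∑ A ∈ P, f (insert (ahat A) S) - f S =
      (∑ A ∈ P, g (ahat A)) / P.card := by
    simp only [hg, Finset.sum_sub_distrib, Finset.sum_const, nsmul_eq_mul]
    field_simp
  have hahatU : ∀ A ∈ P, ahat A ∈ U := fun A hA =>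
    (Finset.mem_powersetCard.1 hA).1 (hahatmem A hA)
  have hD : f Sstar - f S ≤ ∑ a ∈ T, g a := by
    have h := sub_le_sum_marginals hsub hS T hTU
    have h' := hmono Sstar (T ∪ S) (by
      rw [hT, Finset.sdiff_union_self_eq_union]; exact Finset.subset_union_left)
      (Finset.union_subset (hTU.trans Finset.sdiff_subset) hS)
    linarith
  have hG0 : 0 ≤ ∑ a ∈ T, g a := Finset.sum_nonneg fun a ha => hg0 a (hTU ha)
  have hmax : ∀ A ∈ P, ((A ∩ T).card : ℝ)⁻¹ * ∑ a ∈ A ∩ T, g a ≤ g (ahat A) + 2 * r := by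
    intro A hA
    have hahat0 := hg0 _ (hahatU A hA)
    rcases (A ∩ T).eq_empty_or_nonempty with h | h
    · rw [h]; simp only [Finset.sum_empty, mul_zero]; linarith
    · rw [inv_mul_le_iff₀ (by exact_mod_cast h.card_pos), ← nsmul_eq_mul]
      refine Finset.sum_le_card_nsmul _ _ _ fun a ha => ?_
      obtain ⟨haA, haT⟩ := Finset.mem_inter.1 ha
      have h1 := abs_lt.1 (hconc a (hTU haT))
      have h2 := abs_lt.1 (hconc _ (hahatU A hA))
      have h3 := hahatmax A hA a haA
      simp only [hg]
      linarith [h1.1, h2.2]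
  have hsum := Finset.sum_le_sum hmax
  rw [Finset.sum_add_distrib, Finset.sum_const, nsmul_eq_mul] at hsum
  have havg := card_mul_sum_average_inter hTU s g
  have hmiss := card_powersetCard_sdiff_le hTU hk hTk hs hsU hε.1 (by rwa [hUcard])
  rw [← hP] at havg hmiss
  have hmain : (1 - ε) / k * (∑ a ∈ T, g a) * P.card ≤
      ∑ A ∈ P, ((A ∩ T).card : ℝ)⁻¹ * ∑ a ∈ A ∩ T, g a := by
    rcases T.eq_empty_or_nonempty with h | h
    · simp [h]
    · have hT0 : (0 : ℝ) < T.card := by exact_mod_cast h.card_pos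
      refine le_of_mul_le_mul_left ?_ hT0
      rw [havg]
      have h1 : (P.card : ℝ) * ((1 - ε) * T.card / k) ≤
          P.card - ((U \ T).powersetCard s).card := by linarith
      calc _ = (P.card : ℝ) * ((1 - ε) * T.card / k) * ∑ a ∈ T, g a := by ring
        _ ≤ _ := by gcongr
  rw [hexp, ge_iff_le, le_div_iff₀ hP0]
  have hε1 : 0 ≤ (1 - ε) / k := div_nonneg (by linarith [hε.2]) hk'.le
  have h1 : (1 - ε) / k * (f Sstar - f S) * P.card ≤ (1 - ε) / k * (∑ a ∈ T, g a) * P.card := by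
    gcongr
  linarith
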